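/- Fix n ≥ 4, 1 ≤ i ≤ n−2 and m ≥ 1. Suppose φ_1,...,φ_m, χ_1,...,χ_m ∈ S_n satisfy v_{0,i} ⪰ φ_1 ⪰ φ_2 ⪰ ... ⪰ φ_m ⪰ χ_1 ⪰ χ_2 ⪰ ... ⪰ χ_m in the Ehresmann order, and that the multiset {φ_1(1),...,φ_m(1)} equals the multiset {χ_1(n),...,χ_m(n)}. Then φ_k(1) = i+2 and χ_k(n) = i+2 for every k. (This is the combinatorial content of the paper's Lemma that the only torus-invariant standard monomial of shape m(ω_1+ω_{n−1}) on X(v_{0,i}) is the m-th power of the unique invariant of degree one.) -/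

import Mathlib

/-- `f` is (the one-line function of) a permutation of `{1,...,n}`. -/
def IsPermOn (n : ℕ) (f : ℕ → ℕ) : Prop :=
  Set.BijOn f (Set.Icc 1 n) (Set.Icc 1 n)

/-- `π_k(f)`: the increasing rearrangement of `(f 1, ..., f k)`, as a list. -/
def piSort (f : ℕ → ℕ) (k : ℕ) : List ℕ :=
  ((List.range' 1 k).map f).insertionSort (· ≤ ·)

/-- The Ehresmann (tableau) order: `u ⪯ w` iff `π_k(u) ≤ π_k(w)` entrywise for all `k`. -/
def Ehr (n : ℕ) (u w : ℕ → ℕ) : Prop :=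
  ∀ k, 1 ≤ k → k ≤ n → List.Forall₂ (· ≤ ·) (piSort u k) (piSort w k)

/-- `l` is `w`-admissible: there are permutations `χ ⪯ φ ⪯ w` with `φ(1) = l = χ(n)`. -/
def Admissible (n : ℕ) (w : ℕ → ℕ) (l : ℕ) : Prop :=
  ∃ φ χ : ℕ → ℕ, IsPermOn n φ ∧ IsPermOn n χ ∧
    Ehr n χ φ ∧ Ehr n φ w ∧ φ 1 = l ∧ χ n = l

/-- The minimal element `v_{0,i}` of `S_n`, with one-line notation
`(i+2, 1, 2, ..., i, i+3, i+4, ..., n, i+1)`. -/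
def v0 (n i : ℕ) : ℕ → ℕ := fun k =>
  if k = 1 then i + 2
  else if k ≤ i + 1 then k - 1
  else if k ≤ n - 1 then k + 1
  else if k = n then i + 1
  else k

lemma ehr_one {n : ℕ} (hn : 1 ≤ n) {u w : ℕ → ℕ} (h : Ehr n u w) : u 1 ≤ w 1 := by
  have := h 1 le_rfl hn
  simpa [piSort] using this

lemma sum_perm {n : ℕ} {u : ℕ → ℕ} (h : IsPermOn n u) :
    ((List.range' 1 n).map u).sum = ∑ x ∈ Finset.Icc 1 n, x := by
  have h1 : ((List.range' 1 n).map u).sum = ∑ x ∈ Finset.Icc 1 n, u x := by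
    rw [← List.sum_toFinset u List.nodup_range']
    congr 1
    ext x
    simp [List.mem_range'_1]
    omega
  rw [h1]
  refine Finset.sum_bij (fun x _ => u x) ?_ ?_ ?_ ?_
  · intro a ha
    simpa using h.mapsTo (by simpa using ha)
  · intro a ha b hb hab
    exact h.injOn (by simpa using ha) (by simpa using hb) hab
  · intro b hb
    obtain ⟨a, ha, e⟩ := h.surjOn (show b ∈ Set.Icc 1 n by simpa using hb)
    exact ⟨a, by simpa using ha, e⟩
  · intros
    rfl

lemma ehr_last {n : ℕ} (hn : 2 ≤ n) {u w : ℕ → ℕ} (hu : IsPermOn n u) (hw : IsPermOn n w)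
    (h : Ehr n u w) : w n ≤ u n := by
  obtain ⟨k, rfl⟩ : ∃ k, n = k + 1 := ⟨n - 1, by omega⟩
  have h1 := (h k (by omega) (by omega)).sum_le_sum
  have e : ∀ f : ℕ → ℕ, (piSort f k).sum = ((List.range' 1 k).map f).sum := fun f =>
    (List.perm_insertionSort _ _).sum_eq
  have e2 : ∀ f : ℕ → ℕ, ((List.range' 1 (k + 1)).map f).sum
      = ((List.range' 1 k).map f).sum + f (k + 1) := by
    intro f
    rw [List.range'_concat]
    simp [add_comm]
  have h2 := sum_perm hu
  have h3 := sum_perm hw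
  rw [e2] at h2 h3
  rw [e, e] at h1
  omega

lemma v0_perm {n i : ℕ} (hn : 4 ≤ n) (hi2 : i ≤ n - 2) :
    IsPermOn n (v0 n i) := by
  have hm : Set.MapsTo (v0 n i) (Set.Icc 1 n) (Set.Icc 1 n) := by
    intro x hx
    simp only [Set.mem_Icc, v0] at *
    split_ifs <;> omega
  have hi : Set.InjOn (v0 n i) (Set.Icc 1 n) := by
    intro x hx y hy hxy
    simp only [Set.mem_Icc, v0] at *
    split_ifs at hxy <;> omega
  exact ⟨hm, hi, by
    have := Finset.surjOn_of_injOn_of_card_le (s := Finset.Icc 1 n) (t := Finset.Icc 1 n) (v0 n i)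
      (by simpa using hm) (by simpa using hi) le_rfl
    simpa using this⟩

lemma chain_anti {m : ℕ} {f : ℕ → ℕ} (h : ∀ k, 1 ≤ k → k < m → f (k + 1) ≤ f k)
    {a b : ℕ} (ha : 1 ≤ a) (hab : a ≤ b) : b ≤ m → f b ≤ f a := by
  induction b, hab using Nat.le_induction with
  | base => intro _; exact le_rfl
  | succ b hb ih => intro hm; exact (h b (by omega) (by omega)).trans (ih (by omega))

lemma chain_mono {m : ℕ} {f : ℕ → ℕ} (h : ∀ k, 1 ≤ k → k < m → f k ≤ f (k + 1))
    {a b : ℕ} (ha : 1 ≤ a) (hab : a ≤ b) : b ≤ m → f a ≤ f b := by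
  induction b, hab using Nat.le_induction with
  | base => intro _; exact le_rfl
  | succ b hb ih => intro hm; exact (ih (by omega)).trans (h b (by omega) (by omega))

theorem stmt7 (n i m : ℕ) (hn : 4 ≤ n) (hi1 : 1 ≤ i) (hi2 : i ≤ n - 2) (hm : 1 ≤ m)
    (φ χ : ℕ → ℕ → ℕ)
    (hperm : ∀ k, 1 ≤ k → k ≤ m → IsPermOn n (φ k) ∧ IsPermOn n (χ k))
    (hchain1 : Ehr n (φ 1) (v0 n i))
    (hchain2 : ∀ k, 1 ≤ k → k < m → Ehr n (φ (k + 1)) (φ k))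
    (hchain3 : Ehr n (χ 1) (φ m))
    (hchain4 : ∀ k, 1 ≤ k → k < m → Ehr n (χ (k + 1)) (χ k))
    (hmulti : (((List.range' 1 m).map fun k => φ k 1 : List ℕ) : Multiset ℕ)
            = (((List.range' 1 m).map fun k => χ k n : List ℕ) : Multiset ℕ)) :
    ∀ k, 1 ≤ k → k ≤ m → φ k 1 = i + 2 ∧ χ k n = i + 2 := by
  have A := ehr_one (by omega) hchain1
  have B := ehr_last (by omega) (hperm 1 le_rfl hm).1 (v0_perm hn hi2) hchain1
  have v1 : v0 n i 1 = i + 2 := by simp [v0]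
  have vn : v0 n i n = i + 1 := by
    simp only [v0]
    split_ifs <;> omega
  rw [v1] at A
  rw [vn] at B
  have C : ∀ {a b}, 1 ≤ a → a ≤ b → b ≤ m → φ b 1 ≤ φ a 1 := fun ha hab hb =>
    chain_anti (f := fun k => φ k 1) (fun k h1 h2 => ehr_one (by omega) (hchain2 k h1 h2)) ha hab hb
  have D : ∀ {a b}, 1 ≤ a → a ≤ b → b ≤ m → φ a n ≤ φ b n := fun ha hab hb =>
    chain_mono (f := fun k => φ k n) (fun k h1 h2 => ehr_last (by omega)
      (hperm (k + 1) (by omega) (by omega)).1 (hperm k h1 (by omega)).1 (hchain2 k h1 h2)) ha hab hb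
  have E : ∀ {a b}, 1 ≤ a → a ≤ b → b ≤ m → χ a n ≤ χ b n := fun ha hab hb =>
    chain_mono (f := fun k => χ k n) (fun k h1 h2 => ehr_last (by omega)
      (hperm (k + 1) (by omega) (by omega)).2 (hperm k h1 (by omega)).2 (hchain4 k h1 h2)) ha hab hb
  have F := ehr_last (by omega) (hperm 1 le_rfl hm).2 (hperm m hm le_rfl).1 hchain3
  have G := D le_rfl hm le_rfl
  have hmem : ∀ x, (∃ k, (1 ≤ k ∧ k ≤ m) ∧ φ k 1 = x) ↔ (∃ k, (1 ≤ k ∧ k ≤ m) ∧ χ k n = x) := by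
    intro x
    have := congrArg (fun s => x ∈ s) hmulti
    simpa [List.mem_range'_1, Nat.lt_add_one_iff, add_comm 1 m] using this
  have hne : φ m 1 ≠ φ m n := fun h => by
    have := (hperm m hm le_rfl).1.injOn (show 1 ∈ Set.Icc 1 n by simp; omega)
      (show n ∈ Set.Icc 1 n by simp; omega) h
    omega
  obtain ⟨a, ha, ha'⟩ := (hmem _).1 ⟨m, ⟨hm, le_rfl⟩, rfl⟩
  obtain ⟨b, hb, hb'⟩ := (hmem _).2 ⟨1, ⟨le_rfl, hm⟩, rfl⟩
  obtain ⟨c, hc, hc'⟩ := (hmem _).2 ⟨m, ⟨hm, le_rfl⟩, rfl⟩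
  have h1 := E le_rfl ha.1 ha.2
  have h2 := C hb.1 hb.2 le_rfl
  have h3 := C le_rfl hc.1 hc.2
  have h4 := C le_rfl hm le_rfl
  intro k hk hkm
  have h5 := C le_rfl hk hkm
  have h6 := C hk hkm le_rfl
  have h7 := E le_rfl hk hkm
  have h8 := E hk hkm le_rfl
  omega
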